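/- arXiv:1409.6269 — 18 statements merged into one kernel-verified Lean document; each statement's English description precedes it below -/
import Mathlib

section
/- Every finite meet-semidistributive lattice is crosscut-simplicial. That is, if L is a finite lattice such that for all x, y, z ∈ L, x ⊓ z = y ⊓ z implies (x ⊔ y) ⊓ z = x ⊓ z, then for all x ≤ y in L and every proper subset B ⊊ A(x,y) of the set of atoms of the interval [x,y], the join sSup({x} ∪ B) is not equal to y. -/
/-- Every finite meet-semidistributive lattice is crosscut-simplicial: for all `x ≤ y`
and every proper subset `B` of the set of atoms of the interval `[x, y]`,
the join `sSup ({x} ∪ B)` is not equal to `y`. -/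
theorem meetSemidistributive_crosscutSimplicial
    {L : Type*} [CompleteLattice L] [Fintype L]
    (hmsd : ∀ x y z : L, x ⊓ z = y ⊓ z → (x ⊔ y) ⊓ z = x ⊓ z)
    (x y : L) (hxy : x ≤ y)
    (B : Set L) (hB : B ⊂ {z : L | x ⋖ z ∧ z ≤ y}) :
    sSup ({x} ∪ B) ≠ y := by
  intro h
  obtain ⟨hsub, hne⟩ := hB
  obtain ⟨a, ha, haB⟩ := Set.not_subset.mp hne
  have hb : ∀ b ∈ B, b ⊓ a = x := by
    intro b hbB
    have hxb := (hsub hbB).1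
    have hxa := ha.1
    rcases hxa.eq_or_eq (le_inf hxb.le hxa.le) inf_le_right with h1 | h1
    · exact h1
    · exfalso
      have hab : a ≤ b := inf_eq_right.mp h1
      rcases hxb.eq_or_eq hxa.le hab with h2 | h2
      · exact hxa.lt.ne' h2
      · exact haB (h2 ▸ hbB)
  have key : ∀ S : Set L, S.Finite → S ⊆ B → (x ⊔ sSup S) ⊓ a = x := by
    intro S hS
    induction S, hS using Set.Finite.induction_on with
    | empty =>
      intro _
      simpa using ha.1.le
    | @insert c S _ _ ih =>
      intro hsubS
      have h1 := ih (fun s hs => hsubS (Set.mem_insert_of_mem _ hs))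
      have h2 := hb c (hsubS (Set.mem_insert _ _))
      have h3 := hmsd _ _ a (h2.trans h1.symm)
      rw [sSup_insert, sup_left_comm, h3, h2]
  have h4 := key B (Set.toFinite B) subset_rfl
  rw [Set.singleton_union, sSup_insert] at h
  rw [h, inf_eq_right.mpr ha.2] at h4
  exact ha.1.lt.ne' h4
end

section
/- Let L be a finite meet-semidistributive lattice with least element ⊥, and let A = {a ∈ L : ⊥ ⋖ a} be the set of atoms of L. Then for every proper subset B ⊊ A, the join sSup B is strictly smaller than sSup A. -/
/-- In a finite meet-semidistributive lattice, the join of any proper subset of the set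
of atoms is strictly smaller than the join of all the atoms. -/
theorem meetSemidistributive_join_proper_subset_of_atoms_lt
    {L : Type*} [CompleteLattice L] [Fintype L]
    (hmsd : ∀ x y z : L, x ⊓ z = y ⊓ z → (x ⊔ y) ⊓ z = x ⊓ z)
    (B : Set L) (hB : B ⊂ {a : L | ⊥ ⋖ a}) :
    sSup B < sSup {a : L | ⊥ ⋖ a} := by
  obtain ⟨hsub, hne⟩ := hB
  obtain ⟨a, haA, haB⟩ := Set.not_subset.mp hne
  have ha : IsAtom a := bot_covBy_iff.mp haA
  have hbot : ∀ b ∈ B, b ⊓ a = ⊥ := by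
    intro b hb
    have hbA : IsAtom b := bot_covBy_iff.mp (hsub hb)
    have hba : b ≠ a := by
      rintro rfl
      exact haB hb
    exact (hbA.disjoint_of_ne ha hba).eq_bot
  have key : ∀ S : Set L, S.Finite → S ⊆ B → sSup S ⊓ a = ⊥ := by
    intro S hS
    induction S, hS using Set.Finite.induction_on with
    | empty => simp
    | @insert b S _ _ ih =>
      intro h
      have h1 := hbot b (h (Set.mem_insert _ _))
      have h2 := ih ((Set.subset_insert _ _).trans h)
      rw [sSup_insert, hmsd _ _ _ (h1.trans h2.symm), h1]
  refine lt_of_le_of_ne (sSup_le_sSup hsub) ?_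
  intro heq
  have hle : a ≤ sSup B := heq ▸ le_sSup haA
  have h := key B B.toFinite subset_rfl
  rw [inf_eq_right.mpr hle] at h
  exact ha.1 h
end

section
/- Let L be a finite join-semidistributive lattice. Then for all x ≤ y in L and every proper subset B ⊊ K(x,y) of the set of coatoms of the interval [x,y], the meet sInf({y} ∪ B) is not equal to x. (This is the order-dual of the crosscut-simplicial property, and follows by applying the meet-semidistributive result to the dual lattice.) -/
/-- In a finite join-semidistributive lattice, for all `x ≤ y` and every proper subset
`B` of the set of coatoms of the interval `[x, y]`, the meet `sInf ({y} ∪ B)` is not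
equal to `x` (the order-dual of the crosscut-simplicial property). -/
theorem joinSemidistributive_dual_crosscutSimplicial
    {L : Type*} [CompleteLattice L] [Fintype L]
    (hjsd : ∀ x y z : L, x ⊔ z = y ⊔ z → (x ⊓ y) ⊔ z = x ⊔ z)
    (x y : L) (hxy : x ≤ y)
    (B : Set L) (hB : B ⊂ {z : L | z ⋖ y ∧ x ≤ z}) :
    sInf ({y} ∪ B) ≠ x := by
  obtain ⟨hsub, hne⟩ := hB
  obtain ⟨c, ⟨hcy, hxc⟩, hcB⟩ := Set.not_subset.mp hne
  have key : ∀ s : Set L, s.Finite → (∀ b ∈ s, b ⊔ c = y) → sInf ({y} ∪ s) ⊔ c = y := by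
    intro s hs
    induction s, hs using Set.Finite.induction_on with
    | empty =>
      intro _
      simpa using hcy.le
    | @insert a s _ _ ih =>
      intro h
      have h1 := ih (fun b hb => h b (Set.mem_insert_of_mem _ hb))
      have h2 := h a (Set.mem_insert _ _)
      have h3 := hjsd a (sInf ({y} ∪ s)) c (h2.trans h1.symm)
      rw [Set.union_insert, sInf_insert, h3, h2]
  intro hx
  have h := key B (Set.toFinite B) (fun b hb => by
    have hby : b ⋖ y := (hsub hb).1
    have hbc : b ≠ c := fun e => hcB (e ▸ hb)
    exact hby.wcovBy.sup_eq hcy.wcovBy hbc)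
  rw [hx, sup_eq_right.mpr hxc] at h
  exact hcy.ne h
end

section
/- Let L be a finite join-semidistributive lattice with least element ⊥ and greatest element ⊤, let A = {a ∈ L : ⊥ ⋖ a} be its set of atoms, and suppose sSup A = ⊤. If B ⊆ A satisfies sSup B ≠ ⊤ and B is maximal with this property (i.e., for every a ∈ A \ B, sSup (B ∪ {a}) = ⊤), then A \ B is a singleton. Consequently every maximal face of the crosscut complex of L has cardinality |A| − 1. -/
/-- In a finite join-semidistributive lattice whose atoms join to `⊤`, any subset `B`
of the atom set `A` that is maximal with the property `sSup B ≠ ⊤` misses exactly one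
atom; consequently every maximal face of the crosscut complex has cardinality `|A| - 1`. -/
theorem joinSemidistributive_maximal_face
    {L : Type*} [CompleteLattice L] [Fintype L]
    (hjsd : ∀ x y z : L, x ⊔ z = y ⊔ z → (x ⊓ y) ⊔ z = x ⊔ z)
    (hA : sSup {a : L | ⊥ ⋖ a} = ⊤)
    (B : Set L) (hBsub : B ⊆ {a : L | ⊥ ⋖ a}) (hB : sSup B ≠ ⊤)
    (hmax : ∀ a ∈ {a : L | ⊥ ⋖ a} \ B, sSup (B ∪ {a}) = ⊤) :
    (∃ a : L, {a' : L | ⊥ ⋖ a'} \ B = {a}) ∧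
      B.ncard = {a : L | ⊥ ⋖ a}.ncard - 1 := by
  have key : ∃ a : L, {a' : L | ⊥ ⋖ a'} \ B = {a} := by
    have hne : ({a' : L | ⊥ ⋖ a'} \ B).Nonempty := by
      by_contra h
      rw [Set.not_nonempty_iff_eq_empty, Set.diff_eq_empty] at h
      exact hB ((Set.Subset.antisymm hBsub h) ▸ hA)
    obtain ⟨a, ha⟩ := hne
    refine ⟨a, Set.Subset.antisymm ?_ (Set.singleton_subset_iff.2 ha)⟩
    intro b hb
    by_contra hba
    have hba' : b ≠ a := hba
    have h1 := hmax a ha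
    have h2 := hmax b hb
    rw [sSup_union, sSup_singleton, sup_comm] at h1 h2
    have h3 := hjsd a b (sSup B) (h1.trans h2.symm)
    have haA : IsAtom a := bot_covBy_iff.1 ha.1
    have hbA : IsAtom b := bot_covBy_iff.1 hb.1
    have h4 : a ⊓ b = ⊥ := (haA.disjoint_of_ne hbA hba'.symm).eq_bot
    rw [h4, bot_sup_eq, h1] at h3
    exact hB h3
  refine ⟨key, ?_⟩
  obtain ⟨a, ha⟩ := key
  have h := Set.ncard_sdiff_add_ncard_of_subset hBsub (Set.toFinite _)
  rw [ha, Set.ncard_singleton] at h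
  omega
end

section
/- Let L be a finite meet-semidistributive lattice. Then for all x ≤ y in L, the value μ(x,y) of the Möbius function of L lies in {−1, 0, 1}. -/
theorem join_inf_atom {L : Type*} [Lattice L] [OrderBot L] [DecidableEq L]
    (hmsd : ∀ x y z : L, x ⊓ z = y ⊓ z → (x ⊔ y) ⊓ z = x ⊓ z)
    (x a : L) (ha : x ⋖ a) (S : Finset L) (hS : ∀ b ∈ S, x ⋖ b) (haS : a ∉ S) :
    (x ⊔ S.sup id) ⊓ a = x := by
  induction S using Finset.induction_on with
  | empty => simpa using ha.le
  | insert b s hb ih =>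
    have h1 := ih (fun c hc => hS c (Finset.mem_insert_of_mem hc))
      (fun h => haS (Finset.mem_insert_of_mem h))
    have hxb := hS b (Finset.mem_insert_self b s)
    have hne : a ≠ b := fun h => haS (h ▸ Finset.mem_insert_self b s)
    have h2 : b ⊓ a = x := by
      rcases hxb.eq_or_eq (le_inf hxb.le ha.le) inf_le_left with h | h
      · exact h
      · have hba : b ≤ a := inf_eq_left.1 h
        rcases ha.eq_or_eq hxb.le hba with h | h
        · exact absurd h hxb.lt.ne'
        · exact absurd h.symm hne
    have h3 := hmsd b (x ⊔ s.sup id) a (h2.trans h1.symm)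
    rw [Finset.sup_insert, id, sup_left_comm, h3, h2]

theorem mu_formula {L : Type*} [Lattice L] [OrderBot L] [Fintype L] [DecidableEq L]
    [DecidableRel ((· ≤ ·) : L → L → Prop)]
    (hmsd : ∀ x y z : L, x ⊓ z = y ⊓ z → (x ⊔ y) ⊓ z = x ⊓ z)
    (μ : L → L → ℤ)
    (hrefl : ∀ x : L, μ x x = 1)
    (hrec : ∀ x y : L, x < y →
      ∑ z ∈ Finset.univ.filter (fun z : L => x ≤ z ∧ z ≤ y), μ x z = 0)
    (x : L) (A : L → Finset L) (hA : ∀ z b, b ∈ A z ↔ x ⋖ b ∧ b ≤ z)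
    (y : L) (hxy : x ≤ y) :
    μ x y = if x ⊔ (A y).sup id = y then (-1) ^ (A y).card else 0 := by
  induction y using WellFoundedLT.induction with
  | ind y ih =>
  rcases hxy.eq_or_lt with rfl | hlt
  · have : A x = ∅ := by
      ext b
      simp only [hA, Finset.notMem_empty, iff_false]
      exact fun h => h.1.lt.not_ge h.2
    simp [this, hrefl]
  set f : L → ℤ := fun z => if x ⊔ (A z).sup id = z then (-1) ^ (A z).card else 0 with hf
  set I := Finset.univ.filter (fun z : L => x ≤ z ∧ z ≤ y) with hI
  have hyI : y ∈ I := by simp [hI, hxy]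
  have hAJ : ∀ S : Finset L, (∀ b ∈ S, x ⋖ b) → A (x ⊔ S.sup id) = S := by
    intro S hS
    ext a
    rw [hA]
    constructor
    · rintro ⟨h1, h2⟩
      by_contra h
      have := join_inf_atom hmsd x a h1 S hS h
      rw [inf_eq_right.2 h2] at this
      exact h1.lt.ne' this
    · intro h
      exact ⟨hS a h, (Finset.le_sup (f := id) h).trans le_sup_right⟩
  have hfs : ∑ z ∈ I, f z = 0 := by
    have hne : (A y).Nonempty := by
      obtain ⟨a, ha, hay⟩ := exists_covBy_le_of_lt hlt
      exact ⟨a, (hA _ _).2 ⟨ha, hay⟩⟩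
    rw [← Finset.sum_powerset_neg_one_pow_card_of_nonempty hne, hf, ← Finset.sum_filter]
    refine Finset.sum_bij' (fun z _ => A z) (fun S _ => x ⊔ S.sup id) ?_ ?_ ?_ ?_ ?_
    · intro z hz
      simp only [hI, Finset.mem_filter, Finset.mem_univ, true_and] at hz
      rw [Finset.mem_powerset]
      intro b hb
      rw [hA] at hb ⊢
      exact ⟨hb.1, hb.2.trans hz.1.2⟩
    · intro S hS
      rw [Finset.mem_powerset] at hS
      have := hAJ S (fun b hb => ((hA _ _).1 (hS hb)).1)
      simp only [hI, Finset.mem_filter, Finset.mem_univ, true_and]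
      refine ⟨⟨le_sup_left, sup_le hxy (Finset.sup_le fun b hb => ((hA _ _).1 (hS hb)).2)⟩, ?_⟩
      rw [this]
    · intro z hz
      exact (Finset.mem_filter.1 hz).2
    · intro S hS
      rw [Finset.mem_powerset] at hS
      exact hAJ S (fun b hb => ((hA _ _).1 (hS hb)).1)
    · intro z hz
      rfl
  have hμ := hrec x y hlt
  rw [← hI, ← Finset.add_sum_erase I _ hyI] at hμ
  rw [← Finset.add_sum_erase I _ hyI] at hfs
  have hEq : ∑ z ∈ I.erase y, μ x z = ∑ z ∈ I.erase y, f z := by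
    refine Finset.sum_congr rfl fun z hz => ?_
    simp only [hI, Finset.mem_erase, Finset.mem_filter, Finset.mem_univ, true_and] at hz
    exact ih z (lt_of_le_of_ne hz.2.2 hz.1) hz.2.1
  change μ x y = f y
  linarith



open Finset in
/-- The Möbius function of a finite meet-semidistributive lattice only takes the
values `-1`, `0` and `1`. -/
theorem meetSemidistributive_mu_mem
    {L : Type*} [Lattice L] [Fintype L] [DecidableRel ((· ≤ ·) : L → L → Prop)]
    (hmsd : ∀ x y z : L, x ⊓ z = y ⊓ z → (x ⊔ y) ⊓ z = x ⊓ z)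
    (μ : L → L → ℤ)
    (hrefl : ∀ x : L, μ x x = 1)
    (hrec : ∀ x y : L, x < y →
      ∑ z ∈ Finset.univ.filter (fun z : L => x ≤ z ∧ z ≤ y), μ x z = 0)
    (x y : L) (hxy : x ≤ y) :
    μ x y ∈ ({-1, 0, 1} : Set ℤ) := by
  classical
  haveI : Nonempty L := ⟨x⟩
  letI : OrderBot L :=
    { bot := Finset.univ.inf' Finset.univ_nonempty id
      bot_le := fun a => Finset.inf'_le id (Finset.mem_univ a) }
  have h := mu_formula hmsd μ hrefl hrec x
    (fun z => Finset.univ.filter (fun b => x ⋖ b ∧ b ≤ z)) (by simp) y hxy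
  simp only [Set.mem_insert_iff, Set.mem_singleton_iff]
  rw [h]
  split_ifs
  · rcases neg_one_pow_eq_or ℤ (Finset.univ.filter (fun b => x ⋖ b ∧ b ≤ y)).card with h | h
    · exact Or.inr (Or.inr h)
    · exact Or.inl h
  · exact Or.inr (Or.inl rfl)
end

section
/- Let L be a finite crosscut-simplicial lattice. Then for all x ≤ y in L, the value μ(x,y) of the Möbius function of L lies in {−1, 0, 1}. -/
section CrosscutAux

variable {L : Type*} [CompleteLattice L] [Fintype L]

open Classical in
/-- The signed count of sets of atoms over `x` whose join (with `x`) is `y`. -/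
noncomputable def crosscutNu (x y : L) : ℤ :=
  ∑ B ∈ ((Finset.univ.filter (fun z : L => x ⋖ z)).powerset).filter
    (fun B => x ⊔ B.sup id = y), (-1 : ℤ) ^ B.card

open Classical in
lemma crosscutNu_self (x : L) : crosscutNu x x = 1 := by
  unfold crosscutNu
  have : ((Finset.univ.filter (fun z : L => x ⋖ z)).powerset).filter
      (fun B => x ⊔ B.sup id = x) = {∅} := by
    ext B
    simp only [Finset.mem_filter, Finset.mem_powerset, Finset.mem_singleton]
    constructor
    · rintro ⟨h1, h2⟩
      by_contra hne
      obtain ⟨b, hb⟩ := Finset.nonempty_iff_ne_empty.mpr hne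
      have hxb : x ⋖ b := (Finset.mem_filter.mp (h1 hb)).2
      have hle : b ≤ x := by
        rw [← h2]
        exact le_sup_of_le_right (Finset.le_sup (f := id) hb)
      exact absurd hxb.lt (not_lt_of_ge hle)
    · rintro rfl
      simp
  rw [this]
  simp

open Classical in
lemma crosscutNu_sum (x y : L) (hxy : x < y) :
    ∑ z ∈ Finset.univ.filter (fun z : L => x ≤ z ∧ z ≤ y), crosscutNu x z = 0 := by
  have hne : (Finset.univ.filter (fun z : L => x ⋖ z ∧ z ≤ y)).Nonempty := by
    obtain ⟨z, hz, hzy⟩ := exists_covBy_le_of_lt hxy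
    exact ⟨z, by simp [hz, hzy]⟩
  rw [← Finset.sum_powerset_neg_one_pow_card_of_nonempty hne]
  rw [← Finset.sum_fiberwise_of_maps_to
    (t := Finset.univ.filter (fun z : L => x ≤ z ∧ z ≤ y)) 
    (s := (Finset.univ.filter (fun z : L => x ⋖ z ∧ z ≤ y)).powerset)
    (g := fun B : Finset L => x ⊔ B.sup id)]
  · apply Finset.sum_congr rfl
    intro z hz
    have hz' : x ≤ z ∧ z ≤ y := by simpa using hz
    unfold crosscutNu
    apply Finset.sum_congr _ (fun _ _ => rfl)
    ext B
    simp only [Finset.mem_filter, Finset.mem_powerset]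
    constructor
    · rintro ⟨h1, h2⟩
      refine ⟨fun b hb => ?_, h2⟩
      have hxb : x ⋖ b := (Finset.mem_filter.mp (h1 hb)).2
      have hle : b ≤ z := by
        rw [← h2]
        exact le_sup_of_le_right (Finset.le_sup (f := id) hb)
      simp [hxb, hle.trans hz'.2]
    · rintro ⟨h1, h2⟩
      refine ⟨fun b hb => ?_, h2⟩
      have := h1 hb
      simp only [Finset.mem_filter, Finset.mem_univ, true_and] at this ⊢
      exact this.1
  · intro B hB
    rw [Finset.mem_powerset] at hB
    simp only [Finset.mem_filter, Finset.mem_univ, true_and]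
    refine ⟨le_sup_left, sup_le hxy.le (Finset.sup_le fun b hb => ?_)⟩
    exact (Finset.mem_filter.mp (hB hb)).2.2

open Classical in
lemma crosscutNu_mem
    (hccs : ∀ x y : L, x ≤ y → ∀ B : Set L, B ⊂ {z : L | x ⋖ z ∧ z ≤ y} →
      sSup ({x} ∪ B) ≠ y) (x y : L) (hxy : x ≤ y) :
    crosscutNu x y ∈ ({-1, 0, 1} : Set ℤ) := by
  unfold crosscutNu
  have hsub : ((Finset.univ.filter (fun z : L => x ⋖ z)).powerset).filter
      (fun B => x ⊔ B.sup id = y) ⊆ {Finset.univ.filter (fun z : L => x ⋖ z ∧ z ≤ y)} := by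
    intro B hB
    simp only [Finset.mem_filter, Finset.mem_powerset] at hB
    obtain ⟨h1, h2⟩ := hB
    have hs : (B : Set L) ⊆ {z : L | x ⋖ z ∧ z ≤ y} := by
      intro b hb
      refine ⟨(Finset.mem_filter.mp (h1 hb)).2, ?_⟩
      rw [← h2]
      exact le_sup_of_le_right (Finset.le_sup (f := id) hb)
    have hj : sSup ({x} ∪ (B : Set L)) = y := by
      rw [sSup_union, sSup_singleton, ← h2, Finset.sup_id_eq_sSup]
    have heq : (B : Set L) = {z : L | x ⋖ z ∧ z ≤ y} := by
      by_contra hne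
      exact hccs x y hxy B (hs.ssubset_of_ne hne) hj
    rw [Finset.mem_singleton]
    ext z
    have : z ∈ (B : Set L) ↔ z ∈ {z : L | x ⋖ z ∧ z ≤ y} := by rw [heq]
    simpa using this
  rcases Finset.subset_singleton_iff.mp hsub with h | h
  · rw [h]; simp
  · rw [h, Finset.sum_singleton]
    rcases neg_one_pow_eq_or ℤ
      (Finset.univ.filter (fun z : L => x ⋖ z ∧ z ≤ y)).card with h | h <;> rw [h] <;> simp

end CrosscutAux

open Finset in
/-- The Möbius function of a finite crosscut-simplicial lattice only takes the
values `-1`, `0` and `1`. -/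
theorem crosscutSimplicial_mu_mem
    {L : Type*} [CompleteLattice L] [Fintype L]
    [DecidableRel ((· ≤ ·) : L → L → Prop)]
    (hccs : ∀ x y : L, x ≤ y → ∀ B : Set L, B ⊂ {z : L | x ⋖ z ∧ z ≤ y} →
      sSup ({x} ∪ B) ≠ y)
    (μ : L → L → ℤ)
    (hrefl : ∀ x : L, μ x x = 1)
    (hrec : ∀ x y : L, x < y →
      ∑ z ∈ Finset.univ.filter (fun z : L => x ≤ z ∧ z ≤ y), μ x z = 0)
    (x y : L) (hxy : x ≤ y) :
    μ x y ∈ ({-1, 0, 1} : Set ℤ) := by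
  have key : ∀ y : L, x ≤ y → μ x y = crosscutNu x y := by
    intro y
    induction y using WellFoundedLT.induction with
    | _ y ih =>
      intro hxy
      rcases hxy.eq_or_lt with rfl | hlt
      · rw [hrefl, crosscutNu_self]
      · have h1 := hrec x y hlt
        have h2 : ∑ z ∈ Finset.univ.filter (fun z : L => x ≤ z ∧ z ≤ y), crosscutNu x z = 0 := by
          convert crosscutNu_sum x y hlt
        have hy : y ∈ Finset.univ.filter (fun z : L => x ≤ z ∧ z ≤ y) := by simp [hxy]
        have h3 : ∑ z ∈ Finset.univ.filter (fun z : L => x ≤ z ∧ z ≤ y),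
            (μ x z - crosscutNu x z) = 0 := by
          rw [Finset.sum_sub_distrib, h1, h2, sub_zero]
        rw [Finset.sum_eq_single_of_mem y hy] at h3
        · exact sub_eq_zero.mp h3
        · intro z hz hne
          simp only [Finset.mem_filter, Finset.mem_univ, true_and] at hz
          rw [ih z (lt_of_le_of_ne hz.2 hne) hz.1, sub_self]
  rw [key y hxy]
  exact crosscutNu_mem hccs x y hxy
end

section
/- Let L be a finite crosscut-simplicial lattice and let x < y in L, with A = A(x,y) the set of atoms of the interval [x,y]. If sSup({x} ∪ A) = y (the interval is atomic) then μ(x,y) = (−1)^{|A|}; otherwise μ(x,y) = 0. -/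
open Finset in
/-- In a finite crosscut-simplicial lattice, for `x < y` with `A` the set of atoms of
the interval `[x, y]`: if the interval is atomic then `μ(x,y) = (-1)^{|A|}`, and
otherwise `μ(x,y) = 0`. -/
theorem crosscutSimplicial_mu_eq
    {L : Type*} [CompleteLattice L] [Fintype L]
    [DecidableRel ((· ≤ ·) : L → L → Prop)]
    (hccs : ∀ x y : L, x ≤ y → ∀ B : Set L, B ⊂ {z : L | x ⋖ z ∧ z ≤ y} →
      sSup ({x} ∪ B) ≠ y)
    (μ : L → L → ℤ)
    (hrefl : ∀ x : L, μ x x = 1)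
    (hrec : ∀ x y : L, x < y →
      ∑ z ∈ Finset.univ.filter (fun z : L => x ≤ z ∧ z ≤ y), μ x z = 0)
    (x y : L) (hlt : x < y) :
    (sSup ({x} ∪ {z : L | x ⋖ z ∧ z ≤ y}) = y →
        μ x y = (-1) ^ ({z : L | x ⋖ z ∧ z ≤ y}.ncard)) ∧
    (sSup ({x} ∪ {z : L | x ⋖ z ∧ z ≤ y}) ≠ y → μ x y = 0) := by
  classical
  set f : Finset L → L := fun B => sSup ({x} ∪ (B : Set L)) with hf
  have hxf : ∀ B, x ≤ f B := fun B => le_sSup (Or.inl rfl)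
  have hmf : ∀ B : Finset L, ∀ b ∈ B, b ≤ f B := fun B b hb => le_sSup (Or.inr hb)
  have hfle : ∀ (B : Finset L) (w : L), x ≤ w → (∀ b ∈ B, b ≤ w) → f B ≤ w := by
    intro B w hw hB
    refine sSup_le ?_
    rintro b (rfl | hb)
    · exact hw
    · exact hB b hb
  set At : L → Finset L := fun w => Finset.univ.filter (fun z => x ⋖ z ∧ z ≤ w) with hAt
  have hcoe : ∀ w, ((At w : Finset L) : Set L) = {z : L | x ⋖ z ∧ z ≤ w} := by
    intro w; ext z; simp [hAt]
  set g : L → ℤ := fun w => ∑ B ∈ (At w).powerset with f B = w, (-1) ^ B.card with hg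
  have gsum : ∀ w, x < w →
      ∑ z ∈ Finset.univ.filter (fun z : L => x ≤ z ∧ z ≤ w), g z = 0 := by
    intro w hw
    have hne : (At w).Nonempty := by
      obtain ⟨z, hz, hzw⟩ := exists_covBy_le_of_lt hw
      exact ⟨z, by simp [hAt, hz, hzw]⟩
    rw [← Finset.sum_powerset_neg_one_pow_card_of_nonempty hne,
      ← Finset.sum_fiberwise_of_maps_to (s := (At w).powerset)
        (t := Finset.univ.filter (fun z : L => x ≤ z ∧ z ≤ w)) (g := f)]
    · refine Finset.sum_congr rfl fun z hz => ?_
      simp only [Finset.mem_filter, Finset.mem_univ, true_and] at hz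
      refine Finset.sum_congr ?_ fun _ _ => rfl
      ext B
      simp only [Finset.mem_filter, Finset.mem_powerset]
      constructor
      · rintro ⟨h1, h2⟩
        refine ⟨fun b hb => ?_, h2⟩
        have := h1 hb
        simp only [hAt, Finset.mem_filter, Finset.mem_univ, true_and] at this ⊢
        exact ⟨this.1, this.2.trans hz.2⟩
      · rintro ⟨h1, h2⟩
        refine ⟨fun b hb => ?_, h2⟩
        have := h1 hb
        simp only [hAt, Finset.mem_filter, Finset.mem_univ, true_and] at this ⊢
        exact ⟨this.1, h2 ▸ hmf B b hb⟩
    · intro B hB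
      rw [Finset.mem_powerset] at hB
      simp only [Finset.mem_filter, Finset.mem_univ, true_and]
      refine ⟨hxf B, hfle B w hw.le fun b hb => ?_⟩
      have := hB hb
      simp only [hAt, Finset.mem_filter, Finset.mem_univ, true_and] at this
      exact this.2
  have gx : g x = 1 := by
    have h0 : At x = ∅ := by
      ext z
      simp only [hAt, Finset.mem_filter, Finset.mem_univ, true_and, Finset.notMem_empty,
        iff_false]
      rintro ⟨h1, h2⟩
      exact absurd h1.lt h2.not_gt
    have h1 : f ∅ = x := by simp [hf]
    simp [hg, h0, h1, Finset.sum_filter]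
  have key : ∀ w, x ≤ w → μ x w = g w := by
    intro w
    induction w using WellFoundedLT.induction with
    | _ w ih =>
      intro hw
      rcases hw.eq_or_lt with rfl | hw'
      · rw [gx, hrefl]
      · have e1 := hrec x w hw'
        have e2 := gsum w hw'
        have hm : w ∈ Finset.univ.filter (fun z : L => x ≤ z ∧ z ≤ w) := by simp [hw]
        rw [← Finset.add_sum_erase _ _ hm] at e1 e2
        have e3 : ∑ z ∈ (Finset.univ.filter (fun z : L => x ≤ z ∧ z ≤ w)).erase w, μ x z =
            ∑ z ∈ (Finset.univ.filter (fun z : L => x ≤ z ∧ z ≤ w)).erase w, g z := by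
          refine Finset.sum_congr rfl fun z hz => ?_
          simp only [Finset.mem_erase, Finset.mem_filter, Finset.mem_univ, true_and] at hz
          exact ih z (lt_of_le_of_ne hz.2.2 hz.1) hz.2.1
        linarith
  have huniq : ∀ B ∈ (At y).powerset, f B = y → B = At y := by
    intro B hB hBy
    by_contra hne
    refine hccs x y hlt.le (B : Set L) ?_ hBy
    rw [← hcoe, Finset.coe_ssubset]
    exact lt_of_le_of_ne (Finset.mem_powerset.1 hB) hne
  rw [key y hlt.le, ← hcoe, Set.ncard_coe_finset]
  constructor
  · intro h
    have : (At y).powerset.filter (fun B => f B = y) = {At y} := by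
      ext B
      simp only [Finset.mem_filter, Finset.mem_singleton]
      constructor
      · rintro ⟨h1, h2⟩
        exact huniq B h1 h2
      · rintro rfl
        exact ⟨Finset.mem_powerset_self _, h⟩
    simp only [hg]
    rw [this, Finset.sum_singleton]
  · intro h
    simp only [hg]
    refine Finset.sum_eq_zero fun B hB => ?_
    rw [Finset.mem_filter] at hB
    exact absurd (huniq B hB.1 hB.2 ▸ hB.2) h
end

section
/- Let L and M be finite lattices and let f : L → M be a surjective lattice homomorphism (f(a ⊔ b) = f(a) ⊔ f(b) and f(a ⊓ b) = f(a) ⊓ f(b) for all a, b ∈ L). If L is crosscut-simplicial, then M is crosscut-simplicial. -/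
/-- The image of a finite crosscut-simplicial lattice under a surjective lattice
homomorphism (equivalently, a lattice quotient) is crosscut-simplicial. -/
theorem crosscutSimplicial_of_surjective_latticeHom
    {L M : Type*} [CompleteLattice L] [Fintype L] [CompleteLattice M] [Fintype M]
    (f : L → M) (hsurj : Function.Surjective f)
    (hsup : ∀ a b : L, f (a ⊔ b) = f a ⊔ f b)
    (hinf : ∀ a b : L, f (a ⊓ b) = f a ⊓ f b)
    (hccs : ∀ x y : L, x ≤ y → ∀ B : Set L, B ⊂ {z : L | x ⋖ z ∧ z ≤ y} →
      sSup ({x} ∪ B) ≠ y) :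
    ∀ x y : M, x ≤ y → ∀ B : Set M, B ⊂ {z : M | x ⋖ z ∧ z ≤ y} →
      sSup ({x} ∪ B) ≠ y := by
  classical
  intro x y hxy B hB hy
  have hmono : ∀ a b : L, a ≤ b → f a ≤ f b := by
    intro a b hab
    have h := hsup a b
    rw [sup_eq_right.mpr hab] at h
    rw [h]
    exact le_sup_left
  -- a maximal element of the fiber over `x`
  obtain ⟨x₀, hx₀⟩ := hsurj x
  obtain ⟨u, -, hu⟩ := (Set.toFinite {w : L | f w = x}).exists_le_maximal (a := x₀) hx₀
  have hux : f u = x := hu.prop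
  -- every cover of `x` lifts to a cover of `u`
  have hlift : ∀ a : M, x ⋖ a → ∃ z : L, u ⋖ z ∧ f z = a := by
    intro a ha
    obtain ⟨a₀, ha₀⟩ := hsurj a
    have h1 : f (u ⊔ a₀) = a := by
      rw [hsup, hux, ha₀]
      exact sup_eq_right.mpr ha.le
    have h2 : u < u ⊔ a₀ := by
      refine lt_of_le_of_ne le_sup_left ?_
      intro h
      rw [← h, hux] at h1
      exact ha.ne h1
    obtain ⟨z, hz, hza⟩ := exists_covBy_le_of_lt h2
    refine ⟨z, hz, ?_⟩
    have h3 : f z ≤ a := h1 ▸ hmono _ _ hza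
    have h4 : x ≤ f z := hux ▸ hmono _ _ hz.le
    rcases ha.eq_or_eq h4 h3 with h | h
    · exact absurd (hu.le_of_ge h hz.le) (not_le_of_gt hz.lt)
    · exact h
  obtain ⟨hBs, hBn⟩ := hB
  obtain ⟨a, ha, haB⟩ := Set.not_subset.mp hBn
  obtain ⟨z, hz, hza⟩ := hlift a ha.1
  set C : Set L := {w | u ⋖ w ∧ f w ∈ B} with hC
  set v : L := sSup ({u} ∪ C) with hv
  have huv : u ≤ v := le_sSup (Or.inl rfl)
  have hyv : y ≤ f v := by
    rw [← hy]
    refine sSup_le ?_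
    rintro b (hb | hb)
    · rw [Set.mem_singleton_iff.mp hb, ← hux]
      exact hmono _ _ huv
    · obtain ⟨w, hw, hwb⟩ := hlift b (hBs hb).1
      rw [← hwb]
      refine hmono _ _ (le_sSup (Or.inr ⟨hw, ?_⟩))
      rw [hwb]
      exact hb
  have hzv : z ≤ v := by
    rcases hz.eq_or_eq (le_inf hz.le huv) (inf_le_left : z ⊓ v ≤ z) with h | h
    · have h5 := hinf z v
      rw [h, hux, hza, inf_eq_left.mpr (ha.2.trans hyv)] at h5
      exact absurd h5 ha.1.ne
    · exact inf_eq_left.mp h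
  refine hccs u v huv C ⟨?_, ?_⟩ hv.symm
  · intro w hw
    exact ⟨hw.1, le_sSup (Or.inr hw)⟩
  · intro h
    have h6 : f z ∈ B := (h ⟨hz, hzv⟩).2
    rw [hza] at h6
    exact haB h6
end

section
/- Let L and M be finite lattices and let f : L → M be a surjective lattice homomorphism. Let u = sSup {z ∈ L : f(z) = f(⊥)}, where ⊥ is the least element of L. Then f(u) = f(⊥), f(⊥) is the least element of M, and the map a ↦ f(a) is a bijection from {a ∈ L : u ⋖ a} onto {m ∈ M : f(⊥) ⋖ m} (the set of atoms of M). -/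
/-- Let `f : L → M` be a surjective lattice homomorphism of finite lattices and let
`u = sSup {z | f z = f ⊥}`.  Then `f u = f ⊥`, `f ⊥` is the least element of `M`, and
`f` restricts to a bijection from the covers of `u` onto the atoms of `M`. -/
theorem latticeHom_atoms_bijection
    {L M : Type*} [CompleteLattice L] [Fintype L] [CompleteLattice M] [Fintype M]
    (f : L → M) (hsurj : Function.Surjective f)
    (hsup : ∀ a b : L, f (a ⊔ b) = f a ⊔ f b)
    (hinf : ∀ a b : L, f (a ⊓ b) = f a ⊓ f b) :
    f (sSup {z : L | f z = f ⊥}) = f ⊥ ∧ IsBot (f (⊥ : L)) ∧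
      Set.BijOn f {a : L | sSup {z : L | f z = f ⊥} ⋖ a} {m : M | f (⊥ : L) ⋖ m} := by
  classical
  have hu : f (sSup {z : L | f z = f ⊥}) = f ⊥ := by
    have h := Finset.sup_mem {z : L | f z = f ⊥} rfl
      (fun x hx y hy => by
        have hx' : f x = f ⊥ := hx
        have hy' : f y = f ⊥ := hy
        change f (x ⊔ y) = f ⊥
        rw [hsup, hx', hy', sup_idem]) (Set.toFinite {z : L | f z = f ⊥}).toFinset id
      (fun i hi => by simpa using hi)
    have e : (Set.toFinite {z : L | f z = f ⊥}).toFinset.sup id = sSup {z : L | f z = f ⊥} := by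
      rw [Finset.sup_id_eq_sSup, Set.Finite.coe_toFinset]
    rw [e] at h
    exact h
  have hmax : ∀ z, f z = f ⊥ → z ≤ sSup {z : L | f z = f ⊥} := fun z hz => le_sSup hz
  generalize sSup {z : L | f z = f ⊥} = u at hu hmax
  have hmono : ∀ a b, a ≤ b → f a ≤ f b := fun a b h => by
    rw [← sup_eq_right, ← hsup, sup_eq_right.2 h]
  have hbot : ∀ x, f ⊥ ≤ f x := fun x => hmono _ _ bot_le
  have hlt : ∀ a, u < a → f ⊥ < f a := fun a ha =>
    lt_of_le_of_ne (hbot a) fun h => ha.not_ge (hmax a h.symm)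
  refine ⟨hu, fun m => ?_, ?_, ?_, ?_⟩
  · obtain ⟨x, rfl⟩ := hsurj m
    exact hbot x
  · intro a ha
    have ha : u ⋖ a := ha
    refine ⟨hlt a ha.lt, fun m h1 h2 => ?_⟩
    obtain ⟨x, rfl⟩ := hsurj m
    have hy : f ((x ⊔ u) ⊓ a) = f x := by
      rw [hinf, hsup, hu, sup_eq_left.2 h1.le, inf_eq_left.2 h2.le]
    rcases ha.eq_or_eq (le_inf le_sup_right ha.le) (inf_le_right (a := x ⊔ u)) with h | h
    · rw [h, hu] at hy
      exact h1.ne hy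
    · rw [h] at hy
      exact h2.ne hy.symm
  · intro a ha b hb hab
    have ha : u ⋖ a := ha
    have hb : u ⋖ b := hb
    have hf : f (a ⊓ b) = f a := by rw [hinf, hab, inf_idem]
    have hne : a ⊓ b ≠ u := fun h => by
      rw [h, hu] at hf
      exact (hlt a ha.lt).ne hf
    have h1 := (ha.eq_or_eq (le_inf ha.le hb.le) inf_le_left).resolve_left hne
    have h2 := (hb.eq_or_eq (le_inf ha.le hb.le) inf_le_right).resolve_left hne
    exact h1.symm.trans h2
  · intro m hm
    have hm : f ⊥ ⋖ m := hm
    obtain ⟨x, rfl⟩ := hsurj m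
    have hy : f (x ⊔ u) = f x := by rw [hsup, hu, sup_eq_left.2 hm.le]
    have huy : u < x ⊔ u := lt_of_le_of_ne le_sup_right fun h => by
      rw [← h, hu] at hy
      exact hm.lt.ne hy
    obtain ⟨a, ha, hay⟩ := exists_covBy_le_of_lt huy
    refine ⟨a, ha, ?_⟩
    have h1 : f a ≤ f x := hy ▸ hmono _ _ hay
    exact (hm.eq_or_eq (hbot a) h1).resolve_left (hlt a ha.lt).ne'
end

section
/- Let L and M be finite lattices, f : L → M a surjective lattice homomorphism, and x ≤ y in M. Then there exist x' ≤ y' in L and a bijection φ from A_L(x',y') = {z ∈ L : x' ⋖ z and z ≤ y'} to A_M(x,y) = {m ∈ M : x ⋖ m and m ≤ y} such that for every subset B ⊆ A_L(x',y'), sSup({x'} ∪ B) = y' holds in L if and only if sSup({x} ∪ φ(B)) = y holds in M. (The crosscut complex of any interval of a lattice quotient is isomorphic to the crosscut complex of some interval of the lattice.) -/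
theorem crosscut_map_sSup {L M : Type*} [CompleteLattice L] [Fintype L] [CompleteLattice M]
    (f : L → M) (hsup : ∀ a b : L, f (a ⊔ b) = f a ⊔ f b) (a : L) (B : Set L) :
    f (sSup ({a} ∪ B)) = sSup ({f a} ∪ f '' B) := by
  induction B, B.toFinite using Set.Finite.induction_on with
  | empty => simp
  | @insert b s _ _ ih =>
    rw [Set.image_insert_eq, Set.union_insert, Set.union_insert, sSup_insert, sSup_insert, hsup, ih]

theorem crosscut_exists_least {L : Type*} [CompleteLattice L] [Fintype L] (P : L → Prop)
    (h0 : ∃ a, P a) (h : ∀ a b, P a → P b → P (a ⊓ b)) : ∃ a, P a ∧ ∀ b, P b → a ≤ b := by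
  obtain ⟨m, hm⟩ := Set.Finite.exists_minimal (Set.toFinite {a | P a}) h0
  exact ⟨m, hm.prop, fun b hb =>
    (hm.le_of_le (h m b hm.prop hb) inf_le_left).trans inf_le_right⟩

theorem crosscut_exists_greatest {L : Type*} [CompleteLattice L] [Fintype L] (P : L → Prop)
    (h0 : ∃ a, P a) (h : ∀ a b, P a → P b → P (a ⊔ b)) : ∃ a, P a ∧ ∀ b, P b → b ≤ a := by
  obtain ⟨m, hm⟩ := Set.Finite.exists_maximal (Set.toFinite {a | P a}) h0
  exact ⟨m, hm.prop, fun b hb =>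
    le_sup_right.trans (hm.le_of_ge (h m b hm.prop hb) le_sup_left)⟩

/-- The crosscut complex of any interval of a lattice quotient is isomorphic to the
crosscut complex of some interval of the lattice: given a surjective lattice
homomorphism `f : L → M` and `x ≤ y` in `M`, there are `x' ≤ y'` in `L` and a
bijection `φ` between the atom sets of `[x', y']` and `[x, y]` such that a set `B` of
atoms of `[x', y']` joins (with `x'`) to `y'` iff `φ(B)` joins (with `x`) to `y`. -/
theorem crosscut_complex_of_quotient_interval
    {L M : Type*} [CompleteLattice L] [Fintype L] [CompleteLattice M] [Fintype M]
    (f : L → M) (hsurj : Function.Surjective f)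
    (hsup : ∀ a b : L, f (a ⊔ b) = f a ⊔ f b)
    (hinf : ∀ a b : L, f (a ⊓ b) = f a ⊓ f b)
    (x y : M) (hxy : x ≤ y) :
    ∃ x' y' : L, x' ≤ y' ∧ ∃ φ : L → M,
      Set.BijOn φ {z : L | x' ⋖ z ∧ z ≤ y'} {m : M | x ⋖ m ∧ m ≤ y} ∧
      ∀ B ⊆ {z : L | x' ⋖ z ∧ z ≤ y'},
        (sSup ({x'} ∪ B) = y' ↔ sSup ({x} ∪ φ '' B) = y) := by
  have hmono : ∀ a b : L, a ≤ b → f a ≤ f b := fun a b hab => by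
    rw [← sup_eq_right, ← hsup, sup_eq_right.2 hab]
  obtain ⟨y', hy', hmin⟩ := crosscut_exists_least (fun a => f a = y) (hsurj y)
    (fun a b ha hb => by rw [hinf, ha, hb, inf_idem])
  obtain ⟨x', ⟨hx', hxy'⟩, hmax⟩ := crosscut_exists_greatest (fun a => f a = x ∧ a ≤ y')
    (by
      obtain ⟨w, hw⟩ := hsurj x
      exact ⟨w ⊓ y', by rw [hinf, hw, hy', inf_eq_left.2 hxy], inf_le_right⟩)
    (fun a b ha hb => ⟨by rw [hsup, ha.1, hb.1, sup_idem], sup_le ha.2 hb.2⟩)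
  -- elements strictly above `x'` in the interval map strictly above `x`
  have hlt : ∀ w, x' < w → w ≤ y' → x < f w := fun w h1 h2 =>
    lt_of_le_of_ne (hx' ▸ hmono _ _ h1.le) fun h => not_le_of_gt h1 (hmax w ⟨h.symm, h2⟩)
  -- lifting elements of `[x, f z]` to `[x', z]`
  have hlift : ∀ z m, x' ≤ z → x ≤ m → m ≤ f z → ∃ w, x' ≤ w ∧ w ≤ z ∧ f w = m := by
    intro z m h1 h2 h3
    obtain ⟨w, hw⟩ := hsurj m
    refine ⟨(w ⊔ x') ⊓ z, le_inf le_sup_right h1, inf_le_right, ?_⟩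
    rw [hinf, hsup, hw, hx', sup_eq_left.2 h2, inf_eq_left.2 h3]
  refine ⟨x', y', hxy', f, ⟨?_, ?_, ?_⟩, ?_⟩
  · rintro z ⟨hz, hzy⟩
    refine ⟨⟨hlt z hz.lt hzy, fun m h1 h2 => ?_⟩, hy' ▸ hmono _ _ hzy⟩
    obtain ⟨w, hw1, hw2, rfl⟩ := hlift z m hz.le h1.le h2.le
    have h3 : x' < w := lt_of_le_of_ne hw1 (by rintro rfl; exact h1.ne hx'.symm)
    have h4 : w < z := lt_of_le_of_ne hw2 (by rintro rfl; exact h2.ne rfl)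
    exact hz.2 h3 h4
  · rintro z ⟨hz, hzy⟩ v ⟨hv, hvy⟩ hzv
    have hne : x' < z ⊓ v := by
      refine lt_of_le_of_ne (le_inf hz.le hv.le) fun h => ?_
      have h1 := hlt z hz.lt hzy
      have h2 : f (z ⊓ v) = f z := by rw [hinf, ← hzv, inf_idem]
      rw [← h, hx'] at h2
      exact h1.ne h2
    have e1 : z ⊓ v = z := (hz.eq_or_eq hne.le inf_le_left).resolve_left hne.ne'
    have e2 : z ⊓ v = v := (hv.eq_or_eq hne.le inf_le_right).resolve_left hne.ne'
    exact e1.symm.trans e2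
  · rintro m ⟨hm, hmy⟩
    obtain ⟨z, ⟨hz1, hz2, hz3⟩, hz⟩ := crosscut_exists_least
      (fun w => x' ≤ w ∧ w ≤ y' ∧ f w = m) (hlift y' m hxy' hm.le (hy'.symm ▸ hmy))
      (fun a b ha hb => ⟨le_inf ha.1 hb.1, inf_le_left.trans ha.2.1, by
        rw [hinf, ha.2.2, hb.2.2, inf_idem]⟩)
    refine ⟨z, ⟨⟨lt_of_le_of_ne hz1 ?_, fun w h1 h2 => ?_⟩, hz2⟩, hz3⟩
    · rintro rfl
      exact hm.ne (hx'.symm.trans hz3)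
    · have hwy := h2.le.trans hz2
      have h3 := hlt w h1 hwy
      have h4 : f w ≤ m := hz3 ▸ hmono _ _ h2.le
      exact not_le_of_gt h2 (hz w ⟨h1.le, hwy, (hm.eq_or_eq h3.le h4).resolve_left h3.ne'⟩)
  · intro B hB
    rw [← hx', ← crosscut_map_sSup f hsup]
    constructor
    · intro h
      rw [h, hy']
    · intro h
      refine le_antisymm (sSup_le ?_) (hmin _ h)
      rintro b (rfl | hb)
      · exact hxy'
      · exact (hB hb).2
end

section
/- Let P be a finite bounded partial order (P has a least and a greatest element). Suppose that whenever x, a, b ∈ P satisfy x ⋖ a and x ⋖ b, the pair {a, b} has a least upper bound in P. Then P is a lattice: every pair of elements of P has a least upper bound and a greatest lower bound. -/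
theorem joins_above {P : Type*} [PartialOrder P] [Fintype P]
    (h : ∀ x a b : P, x ⋖ a → x ⋖ b → ∃ s : P, IsLUB {a, b} s) (x : P) :
    ∀ a b : P, x ≤ a → x ≤ b → ∃ s : P, IsLUB {a, b} s := by
  induction x using WellFoundedGT.induction with
  | ind x ih =>
    intro a b ha hb
    rcases ha.eq_or_lt with rfl | ha'
    · exact ⟨b, by simp [IsLUB, IsLeast, upperBounds, lowerBounds, hb]⟩
    rcases hb.eq_or_lt with rfl | hb'
    · exact ⟨a, by simp +contextual [IsLUB, IsLeast, upperBounds, lowerBounds, ha]⟩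
    obtain ⟨a', hxa, haa⟩ := exists_covBy_le_of_lt ha'
    obtain ⟨b', hxb, hbb⟩ := exists_covBy_le_of_lt hb'
    obtain ⟨c, hc⟩ := h x a' b' hxa hxb
    have hac : a' ≤ c := hc.1 (by simp)
    have hbc : b' ≤ c := hc.1 (by simp)
    obtain ⟨d, hd⟩ := ih a' hxa.lt a c haa hac
    have had : a ≤ d := hd.1 (by simp)
    have hcd : c ≤ d := hd.1 (by simp)
    obtain ⟨e, he⟩ := ih b' hxb.lt b d hbb (hbc.trans hcd)
    have hbe : b ≤ e := he.1 (by simp)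
    have hde : d ≤ e := he.1 (by simp)
    refine ⟨e, ?_, ?_⟩
    · rintro y (rfl | rfl)
      · exact had.trans hde
      · exact hbe
    · intro u hu
      have hau : a ≤ u := hu (by simp)
      have hbu : b ≤ u := hu (by simp)
      have hcu : c ≤ u := hc.2 (by
        rintro y (rfl | rfl)
        · exact haa.trans hau
        · exact hbb.trans hbu)
      have hdu : d ≤ u := hd.2 (by rintro y (rfl | rfl) <;> assumption)
      exact he.2 (by rintro y (rfl | rfl) <;> assumption)

/-- A finite bounded poset in which every pair of elements covering a common element
has a least upper bound is a lattice: every pair of elements has a least upper bound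
and a greatest lower bound. -/
theorem lattice_of_local_joins
    {P : Type*} [PartialOrder P] [Fintype P] [BoundedOrder P]
    (h : ∀ x a b : P, x ⋖ a → x ⋖ b → ∃ s : P, IsLUB {a, b} s) :
    ∀ a b : P, (∃ s : P, IsLUB {a, b} s) ∧ (∃ i : P, IsGLB {a, b} i) := by
  have J : ∀ a b : P, ∃ s : P, IsLUB {a, b} s :=
    fun a b => joins_above h ⊥ a b bot_le bot_le
  intro a b
  refine ⟨J a b, ?_⟩
  obtain ⟨m, hm⟩ := (Set.toFinite (lowerBounds {a, b})).exists_maximal ⟨⊥, fun _ _ => bot_le⟩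
  refine ⟨m, hm.prop, fun l hl => ?_⟩
  obtain ⟨s, hs⟩ := J m l
  have hms : m ≤ s := hs.1 (by simp)
  have hls : l ≤ s := hs.1 (by simp)
  have hsL : s ∈ lowerBounds {a, b} := fun y hy => hs.2 (by
    rintro z (rfl | rfl)
    · exact hm.prop hy
    · exact hl hy)
  exact hls.trans (hm.le_of_ge hsL hms)
end

section
/- Let L be a finite lattice, C ⊆ L an order-convex subset, U = {z ∈ L : ∃ c ∈ C, c ≤ z}, and let S = (((L \ U) ∪ C) × {false}) ∪ (U × {true}) ⊆ L × Bool, with the componentwise order (Bool ordered by false < true). For (x,ε), (y,ε') ∈ S: if x ⊔ y ∈ (L \ U) ∪ C, then (x ⊔ y, max ε ε') belongs to S and is the least upper bound of {(x,ε), (y,ε')} within S; otherwise, (x ⊔ y, true) belongs to S and is the least upper bound of {(x,ε), (y,ε')} within S. -/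
/-- The doubling `L[C]` of a lattice `L` at an order-convex subset `C`, as a subset of
`L × Bool` with the componentwise order (`false < true`). -/
def doubling {L : Type*} [Lattice L] (C : Set L) : Set (L × Bool) :=
  (({z : L | ∃ c ∈ C, c ≤ z}ᶜ ∪ C) ×ˢ ({false} : Set Bool)) ∪
    ({z : L | ∃ c ∈ C, c ≤ z} ×ˢ ({true} : Set Bool))

/-- Joins in the doubling of a finite lattice at an order-convex subset: for
`(x, ε), (y, ε')` in `L[C]`, if `x ⊔ y ∈ (L \ U) ∪ C` then `(x ⊔ y, max ε ε')` is the
least upper bound of the pair within `L[C]`, and otherwise `(x ⊔ y, true)` is. -/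
theorem doubling_join
    {L : Type*} [Lattice L] [Fintype L] (C : Set L)
    (hconv : ∀ x ∈ C, ∀ y ∈ C, ∀ z : L, x ≤ z → z ≤ y → z ∈ C)
    (x y : L) (ε ε' : Bool)
    (hx : (x, ε) ∈ doubling C) (hy : (y, ε') ∈ doubling C) :
    (x ⊔ y ∈ {z : L | ∃ c ∈ C, c ≤ z}ᶜ ∪ C →
      IsLeast {w : L × Bool | w ∈ doubling C ∧ (x, ε) ≤ w ∧ (y, ε') ≤ w}
        (x ⊔ y, max ε ε')) ∧
    (x ⊔ y ∉ {z : L | ∃ c ∈ C, c ≤ z}ᶜ ∪ C →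
      IsLeast {w : L × Bool | w ∈ doubling C ∧ (x, ε) ≤ w ∧ (y, ε') ≤ w}
        (x ⊔ y, true)) := by
  have mem : ∀ (z : L) (b : Bool), (z, b) ∈ doubling C ↔
      ((z ∈ {z : L | ∃ c ∈ C, c ≤ z}ᶜ ∪ C) ∧ b = false) ∨ ((∃ c ∈ C, c ≤ z) ∧ b = true) := by
    intro z b
    simp only [doubling, Set.mem_union, Set.mem_prod, Set.mem_singleton_iff, Set.mem_setOf_eq]
  constructor
  · intro h
    refine ⟨⟨?_, ⟨le_sup_left, le_max_left _ _⟩, ⟨le_sup_right, le_max_right _ _⟩⟩, ?_⟩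
    · rw [mem] at hx hy ⊢
      rcases hx with ⟨_, rfl⟩ | ⟨⟨c, hc, hcx⟩, rfl⟩
      · rcases hy with ⟨_, rfl⟩ | ⟨⟨c, hc, hcy⟩, rfl⟩
        · exact Or.inl ⟨h, rfl⟩
        · exact Or.inr ⟨⟨c, hc, hcy.trans le_sup_right⟩, rfl⟩
      · exact Or.inr ⟨⟨c, hc, hcx.trans le_sup_left⟩, by simp⟩
    · rintro ⟨z, b⟩ ⟨_, ⟨h1, h2⟩, ⟨h3, h4⟩⟩
      exact ⟨sup_le h1 h3, max_le h2 h4⟩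
  · intro h
    have hU : ∃ c ∈ C, c ≤ x ⊔ y := by
      by_contra hn
      exact h (Or.inl hn)
    have hC : x ⊔ y ∉ C := fun hn => h (Or.inr hn)
    obtain ⟨c, hc, hcz⟩ := hU
    refine ⟨⟨(mem _ _).2 (Or.inr ⟨⟨c, hc, hcz⟩, rfl⟩), ⟨le_sup_left, Bool.le_true _⟩,
      ⟨le_sup_right, Bool.le_true _⟩⟩, ?_⟩
    rintro ⟨z, b⟩ ⟨hw, ⟨h1, h2⟩, ⟨h3, h4⟩⟩
    have hz : x ⊔ y ≤ z := sup_le h1 h3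
    rw [mem] at hw
    rcases hw with ⟨hn | hzC, _⟩ | ⟨_, rfl⟩
    · exact absurd ⟨c, hc, hcz.trans hz⟩ hn
    · exact absurd (hconv c hc z hzC _ hcz hz) hC
    · exact ⟨hz, le_rfl⟩
end

section
/- Let L be a finite crosscut-simplicial lattice, C ⊆ L an order-convex subset, U = {z ∈ L : ∃ c ∈ C, c ≤ z}, and S = (((L \ U) ∪ C) × {false}) ∪ (U × {true}) ⊆ L × Bool with the componentwise order. Suppose that for every x ∈ C and y ∈ L \ C with x ≤ y, there exists a ∈ L with x ⋖ a, a ≤ y, and a ∉ C. Then S is crosscut-simplicial: for all s ≤ t in S and every proper subset B ⊊ {z ∈ S : s ⋖ z in S and z ≤ t}, the element t is not a least upper bound of {s} ∪ B within S. -/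
theorem mem_doubling_false {L : Type*} [Lattice L] (C : Set L) (x : L) :
    (x, false) ∈ doubling C ↔ ((∃ c ∈ C, c ≤ x) → x ∈ C) := by
  simp only [doubling, Set.mem_union, Set.mem_prod, Set.mem_compl_iff, Set.mem_ofPred_eq,
    Set.mem_singleton_iff]
  simp only [reduceCtorEq, and_false, or_false, and_true]
  exact imp_iff_not_or.symm

theorem mem_doubling_true {L : Type*} [Lattice L] (C : Set L) (x : L) :
    (x, true) ∈ doubling C ↔ (∃ c ∈ C, c ≤ x) := by
  simp [doubling]

theorem doubling_cover {L : Type*} [Lattice L] (C : Set L)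
    (hconv : ∀ x ∈ C, ∀ y ∈ C, ∀ z : L, x ≤ z → z ≤ y → z ∈ C)
    (s z : ↥(doubling C)) (h : s ⋖ z) : s.1.1 = z.1.1 ∨ s.1.1 ⋖ z.1.1 := by
  by_contra hne
  push Not at hne
  obtain ⟨hne, hnc⟩ := hne
  have hle : s.1.1 ≤ z.1.1 := h.le.1
  have hlt : s.1.1 < z.1.1 := lt_of_le_of_ne hle hne
  rw [not_covBy_iff hlt] at hnc
  obtain ⟨a, ha1, ha2⟩ := hnc
  have key : ∀ e, (a, e) ∈ doubling C → s.1.2 ≤ e → e ≤ z.1.2 → False := by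
    intro e he h1 h2
    refine h.2 (c := ⟨(a, e), he⟩) ?_ ?_
    · refine lt_of_le_of_ne ⟨ha1.le, h1⟩ ?_
      intro hh
      exact ha1.ne (congrArg (fun w => w.1.1) hh)
    · refine lt_of_le_of_ne ⟨ha2.le, h2⟩ ?_
      intro hh
      exact ha2.ne (congrArg (fun w => w.1.1) hh)
  have h12 : s.1.2 ≤ z.1.2 := h.le.2
  obtain ⟨⟨x, d⟩, hs⟩ := s
  obtain ⟨⟨y, e⟩, hz⟩ := z
  simp only at *
  by_cases haU : ∃ c ∈ C, c ≤ a
  · cases e with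
    | true => exact key true ((mem_doubling_true C a).2 haU) (Bool.le_true _) le_rfl
    | false =>
      obtain ⟨c, hc, hca⟩ := haU
      have hy := (mem_doubling_false C y).1 hz ⟨c, hc, hca.trans ha2.le⟩
      exact key false ((mem_doubling_false C a).2 fun _ => hconv c hc y hy a hca ha2.le) h12 le_rfl
  · cases d with
    | true =>
      obtain ⟨c, hc, hcx⟩ := (mem_doubling_true C x).1 hs
      exact haU ⟨c, hc, hcx.trans ha1.le⟩
    | false =>
      exact key false ((mem_doubling_false C a).2 fun hh => absurd hh haU) le_rfl (Bool.false_le _)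

theorem doubling_lub {L : Type*} [CompleteLattice L] (C : Set L)
    (D : Set ↥(doubling C)) (t : ↥(doubling C)) (h : IsLUB D t) :
    t.1.1 ≤ sSup ((fun w : ↥(doubling C) => w.1.1) '' D) := by
  have hle : ∀ w ∈ D, w.1.1 ≤ sSup ((fun w : ↥(doubling C) => w.1.1) '' D) :=
    fun w hw => le_sSup ⟨w, hw, rfl⟩
  generalize sSup ((fun w : ↥(doubling C) => w.1.1) '' D) = j at *
  by_cases hj : ∃ c ∈ C, c ≤ j
  · have : t ≤ ⟨(j, true), (mem_doubling_true C j).2 hj⟩ :=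
      h.2 fun w hw => ⟨hle w hw, Bool.le_true _⟩
    exact this.1
  · have : t ≤ ⟨(j, false), (mem_doubling_false C j).2 fun hh => absurd hh hj⟩ := by
      refine h.2 fun w hw => ⟨hle w hw, ?_⟩
      have h1 := hle w hw
      obtain ⟨⟨x, d⟩, hx⟩ := w
      cases d with
      | false => exact le_rfl
      | true =>
        obtain ⟨c, hc, hcx⟩ := (mem_doubling_true C x).1 hx
        exact absurd ⟨c, hc, hcx.trans h1⟩ hj
    exact this.1

theorem covers_eq {P : Type*} [PartialOrder P] {s a b : P} (ha : s ⋖ a) (hb : s ⋖ b)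
    (h : a ≤ b) : a = b := by
  rcases h.eq_or_lt with h | h
  · exact h
  · exact absurd h (hb.2 ha.1)

/-- If `L` is a finite crosscut-simplicial lattice and `C` is an order-convex subset
such that every interval `[x, y]` with `x ∈ C`, `y ∉ C` contains an atom not in `C`,
then the doubling `L[C]` is crosscut-simplicial. -/
theorem doubling_crosscutSimplicial
    {L : Type*} [CompleteLattice L] [Fintype L] (C : Set L)
    (hccs : ∀ x y : L, x ≤ y → ∀ B : Set L, B ⊂ {z : L | x ⋖ z ∧ z ≤ y} →
      sSup ({x} ∪ B) ≠ y)
    (hconv : ∀ x ∈ C, ∀ y ∈ C, ∀ z : L, x ≤ z → z ≤ y → z ∈ C)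
    (hcond : ∀ x ∈ C, ∀ y : L, y ∉ C → x ≤ y → ∃ a : L, x ⋖ a ∧ a ≤ y ∧ a ∉ C)
    (s t : ↥(doubling C)) (hst : s ≤ t)
    (B : Set ↥(doubling C)) (hB : B ⊂ {z : ↥(doubling C) | s ⋖ z ∧ z ≤ t}) :
    ¬ IsLUB ({s} ∪ B) t := by
  intro hlub
  obtain ⟨hsub, hns⟩ := hB
  obtain ⟨z, hz, hzB⟩ := Set.not_subset.1 hns
  have hBt : ∀ b ∈ B, s ⋖ b ∧ b ≤ t := fun b hb => hsub hb
  -- every atom of the projected interval is the projection of an element of `B`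
  have hatoms : ∀ a, s.1.1 ⋖ a → a ≤ t.1.1 → ∃ b ∈ B, b.1.1 = a := by
    intro a ha hat
    by_contra hno
    push Not at hno
    refine hccs s.1.1 t.1.1 hst.1
      ({w | ∃ b ∈ B, b.1.1 = w} ∩ {w | s.1.1 ⋖ w ∧ w ≤ t.1.1}) ?_ ?_
    · refine ⟨Set.inter_subset_right, fun hh => ?_⟩
      obtain ⟨b, hb, hba⟩ := (hh (show a ∈ _ from ⟨ha, hat⟩)).1
      exact hno b hb hba
    · apply le_antisymm
      · apply sSup_le
        rintro w (hw | hw)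
        · rw [Set.mem_singleton_iff] at hw
          rw [hw]
          exact hst.1
        · exact hw.2.2
      · refine (doubling_lub C _ t hlub).trans (sSup_le ?_)
        rintro _ ⟨w, hw | hw, rfl⟩
        · rw [Set.mem_singleton_iff] at hw
          rw [hw]
          exact le_sSup (Or.inl rfl)
        · rcases doubling_cover C hconv s w (hBt w hw).1 with h | h
          · exact le_sSup (Or.inl h.symm)
          · exact le_sSup (Or.inr ⟨⟨w, hw, rfl⟩, h, (hBt w hw).2.1⟩)
  rcases doubling_cover C hconv s z hz.1 with h | h
  · have hs2 : s.1.2 = false ∧ z.1.2 = true := by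
      have h2 : s.1.2 ≤ z.1.2 := hz.1.le.2
      have hne : s.1.2 ≠ z.1.2 := fun hh => hz.1.ne (Subtype.ext (Prod.ext h hh))
      revert h2 hne
      cases s.1.2 <;> cases z.1.2 <;> simp
    have hzU : ∃ c ∈ C, c ≤ s.1.1 := by
      have h1 : (z.1.1, z.1.2) ∈ doubling C := z.2
      rw [hs2.2, ← h] at h1
      exact (mem_doubling_true C _).1 h1
    have hsC : s.1.1 ∈ C := by
      have h1 : (s.1.1, s.1.2) ∈ doubling C := s.2
      rw [hs2.1] at h1
      exact (mem_doubling_false C _).1 h1 hzU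
    have hBf : ∀ b ∈ B, b.1.2 = false := by
      intro b hb
      by_contra hbt
      rw [Bool.not_eq_false] at hbt
      have hzb : z ≤ b := by
        refine ⟨?_, ?_⟩
        · have h1 : s.1.1 ≤ b.1.1 := (hBt b hb).1.le.1
          exact h ▸ h1
        · show z.1.2 ≤ b.1.2
          rw [hbt]
          exact Bool.le_true _
      exact hzB (covers_eq hz.1 (hBt b hb).1 hzb ▸ hb)
    by_cases hy : t.1.1 ∈ C
    · have htf : t ≤ ⟨(t.1.1, false), (mem_doubling_false C _).2 fun _ => hy⟩ := by
        refine hlub.2 ?_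
        rintro w (hw | hw)
        · rw [Set.mem_singleton_iff] at hw
          rw [hw]
          exact ⟨hst.1, hs2.1.le⟩
        · exact ⟨(hBt w hw).2.1, (hBf w hw).le⟩
      have h3 : z.1.2 ≤ false := hz.2.2.trans htf.2
      rw [hs2.2] at h3
      exact absurd h3 (by decide)
    · obtain ⟨a, ha, hat, haC⟩ := hcond _ hsC _ hy hst.1
      obtain ⟨b, hb, hba⟩ := hatoms a ha hat
      have h1 : (b.1.1, b.1.2) ∈ doubling C := b.2
      rw [hBf b hb, hba] at h1
      exact haC ((mem_doubling_false C _).1 h1 ⟨_, hsC, ha.le⟩)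
  · obtain ⟨b, hb, hbz⟩ := hatoms _ h hz.2.1
    rcases le_total b.1.2 z.1.2 with h2 | h2
    · exact hzB (covers_eq (hBt b hb).1 hz.1 ⟨hbz.le, h2⟩ ▸ hb)
    · exact hzB (covers_eq hz.1 (hBt b hb).1 ⟨hbz.ge, h2⟩ ▸ hb)
end

section
/- Let L be a finite crosscut-simplicial lattice and let C ⊆ L be an order filter (an up-set: if x ∈ C and x ≤ z then z ∈ C). Let S = ((L \ C) ∪ C) × {false} ∪ C × {true} = (L × {false}) ∪ (C × {true}) ⊆ L × Bool with the componentwise order. Then S is crosscut-simplicial: for all s ≤ t in S and every proper subset B ⊊ {z ∈ S : s ⋖ z in S and z ≤ t}, the element t is not a least upper bound of {s} ∪ B within S. -/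
/-- The doubling `L[C]` of a lattice `L` at an order filter `C`, as a subset of
`L × Bool` with the componentwise order (`false < true`). -/
def doubledAtFilter {L : Type*} [Lattice L] (C : Set L) : Set (L × Bool) :=
  ((Set.univ : Set L) ×ˢ ({false} : Set Bool)) ∪ (C ×ˢ ({true} : Set Bool))

theorem mem_doubled_iff {L : Type*} [Lattice L] (C : Set L) (x : L) (b : Bool) :
    (x, b) ∈ doubledAtFilter C ↔ b = false ∨ x ∈ C := by
  cases b <;> simp [doubledAtFilter]

theorem doubled_cover {L : Type*} [Lattice L] (C : Set L)
    (hfilter : ∀ x ∈ C, ∀ z : L, x ≤ z → z ∈ C)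
    (s z : ↥(doubledAtFilter C)) (h : s ⋖ z) :
    (s.1.1 ⋖ z.1.1 ∧ z.1.2 = s.1.2) ∨ (z.1.1 = s.1.1 ∧ s.1.2 = false ∧ z.1.2 = true) := by
  obtain ⟨⟨x, a⟩, hs⟩ := s
  obtain ⟨⟨y, b⟩, hz⟩ := z
  have hle : x ≤ y ∧ a ≤ b := h.1.le
  rw [mem_doubled_iff] at hs
  by_cases hab : b = a
  · subst hab
    left
    refine ⟨⟨?_, ?_⟩, rfl⟩
    · refine lt_of_le_of_ne hle.1 ?_
      rintro rfl
      exact h.1.ne rfl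
    · intro c hc1 hc2
      have hc : (c, b) ∈ doubledAtFilter C := by
        rw [mem_doubled_iff]
        exact hs.imp id (fun hx => hfilter _ hx _ (le_of_lt hc1))
      refine h.2 (c := ⟨(c, b), hc⟩) ?_ ?_
      · exact Subtype.mk_lt_mk.2 (Prod.mk_lt_mk_of_lt_of_le hc1 le_rfl)
      · exact Subtype.mk_lt_mk.2 (Prod.mk_lt_mk_of_lt_of_le hc2 le_rfl)
  · right
    have ha : a = false ∧ b = true := by
      have := hle.2
      revert this hab
      cases a <;> cases b <;> simp
    obtain ⟨rfl, rfl⟩ := ha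
    refine ⟨?_, rfl, rfl⟩
    by_contra hne
    refine h.2 (c := ⟨(y, false), (mem_doubled_iff _ _ _).2 (Or.inl rfl)⟩) ?_ ?_
    · exact Subtype.mk_lt_mk.2
        (Prod.mk_lt_mk_of_lt_of_le (lt_of_le_of_ne hle.1 (Ne.symm hne)) le_rfl)
    · exact Subtype.mk_lt_mk.2 (Prod.mk_lt_mk_of_le_of_lt le_rfl (by decide))

/-- If `L` is a finite crosscut-simplicial lattice and `C` is an order filter of `L`,
then the doubling `L[C] = (L × {false}) ∪ (C × {true})` is crosscut-simplicial. -/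
theorem doubling_at_filter_crosscutSimplicial
    {L : Type*} [CompleteLattice L] [Fintype L] (C : Set L)
    (hccs : ∀ x y : L, x ≤ y → ∀ B : Set L, B ⊂ {z : L | x ⋖ z ∧ z ≤ y} →
      sSup ({x} ∪ B) ≠ y)
    (hfilter : ∀ x ∈ C, ∀ z : L, x ≤ z → z ∈ C)
    (s t : ↥(doubledAtFilter C)) (hst : s ≤ t)
    (B : Set ↥(doubledAtFilter C))
    (hB : B ⊂ {z : ↥(doubledAtFilter C) | s ⋖ z ∧ z ≤ t}) :
    ¬ IsLUB ({s} ∪ B) t := by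
  intro hL
  have hcov : ∀ w ∈ B, s ⋖ w ∧ w ≤ t := fun w hw => hB.1 hw
  -- a member of `{s} ∪ B` on the upper level exists if `t` is on the upper level
  have key : t.1.2 = true → s.1.2 = true ∨ ∃ w ∈ B, w.1.2 = true := by
    intro ht
    by_contra hcon
    push Not at hcon
    obtain ⟨h1, h2⟩ := hcon
    have hub : (⟨(t.1.1, false), (mem_doubled_iff _ _ _).2 (Or.inl rfl)⟩ :
        ↥(doubledAtFilter C)) ∈ upperBounds ({s} ∪ B) := by
      rintro w (hw | hw)
      · rw [Set.mem_singleton_iff] at hw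
        subst hw
        exact ⟨hst.1, (Bool.eq_false_of_not_eq_true h1).le⟩
      · exact ⟨(hcov w hw).2.1, (Bool.eq_false_of_not_eq_true (h2 w hw)).le⟩
    have h3 : t.1.2 ≤ false := (hL.2 hub).2
    rw [ht] at h3
    exact absurd h3 (by decide)
  have hmemC : ∀ w : ↥(doubledAtFilter C), w.1.2 = true → w.1.1 ∈ C := by
    intro w hw
    have := (mem_doubled_iff C w.1.1 w.1.2).1 w.2
    simpa [hw] using this
  have hxC : t.1.2 = true → s.1.1 ∈ C := by
    intro ht
    rcases key ht with h | ⟨w, hw, hwt⟩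
    · exact hmemC s h
    · rcases doubled_cover C hfilter s w (hcov w hw).1 with h | h
      · exact hmemC s (h.2 ▸ hwt)
      · exact h.1 ▸ hmemC w hwt
  let P : Set L := {z | s.1.1 ⋖ z ∧ ∃ w ∈ B, w.1.1 = z}
  have hPsub : P ⊆ {z : L | s.1.1 ⋖ z ∧ z ≤ t.1.1} := by
    rintro z ⟨hz, w, hw, rfl⟩
    exact ⟨hz, (hcov w hw).2.1⟩
  have hxu : s.1.1 ≤ sSup ({s.1.1} ∪ P) := le_sSup (Or.inl rfl)
  have hsup : sSup ({s.1.1} ∪ P) = t.1.1 := by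
    apply le_antisymm
    · apply sSup_le
      rintro z (hz | hz)
      · rw [Set.mem_singleton_iff] at hz
        subst hz
        exact hst.1
      · exact (hPsub hz).2
    · have hu : (sSup ({s.1.1} ∪ P), t.1.2) ∈ doubledAtFilter C := by
        rw [mem_doubled_iff]
        by_cases ht : t.1.2 = true
        · exact Or.inr (hfilter _ (hxC ht) _ hxu)
        · exact Or.inl (by simpa using ht)
      have hub : (⟨_, hu⟩ : ↥(doubledAtFilter C)) ∈ upperBounds ({s} ∪ B) := by
        rintro w (hw | hw)
        · rw [Set.mem_singleton_iff] at hw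
          subst hw
          exact ⟨hxu, hst.2⟩
        · refine ⟨?_, (hcov w hw).2.2⟩
          rcases doubled_cover C hfilter s w (hcov w hw).1 with h | h
          · exact le_sSup (Or.inr ⟨h.1, w, hw, rfl⟩)
          · exact h.1.le.trans hxu
      exact (hL.2 hub).1
  have hPall : {z : L | s.1.1 ⋖ z ∧ z ≤ t.1.1} ⊆ P := by
    by_contra hn
    exact hccs _ _ hst.1 P ⟨hPsub, hn⟩ hsup
  obtain ⟨z, hz, hzB⟩ := Set.exists_of_ssubset hB
  rcases doubled_cover C hfilter s z hz.1 with h | h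
  · obtain ⟨-, w, hw, hwz⟩ := hPall ⟨h.1, hz.2.1⟩
    rcases doubled_cover C hfilter s w (hcov w hw).1 with h' | h'
    · have : w = z := Subtype.ext (Prod.ext hwz (h'.2.trans h.2.symm))
      exact hzB (this ▸ hw)
    · exact h.1.1.ne (h'.1.symm.trans hwz)
  · have ht : t.1.2 = true := by
      have h2 : z.1.2 ≤ t.1.2 := hz.2.2
      rw [h.2.2] at h2
      exact top_le_iff.1 h2
    rcases key ht with h' | ⟨w, hw, hwt⟩
    · rw [h.2.1] at h'
      exact absurd h' (by decide)
    · rcases doubled_cover C hfilter s w (hcov w hw).1 with h' | h'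
      · rw [h'.2, h.2.1] at hwt
        exact absurd hwt (by decide)
      · have : w = z := Subtype.ext (Prod.ext (h'.1.trans h.1.symm) (hwt.trans h.2.2.symm))
        exact hzB (this ▸ hw)
end

section
/- Let L be a finite lattice, C ⊆ L an order-convex subset, U = {z ∈ L : ∃ c ∈ C, c ≤ z}, and S = (((L \ U) ∪ C) × {false}) ∪ (U × {true}) ⊆ L × Bool with the componentwise order. Suppose x ∈ L \ U, y ∈ C, and x ≤ y. Then every z ∈ S with (x,false) ⋖ z in S and z ≤ (y,true) satisfies z ≤ (y,false). Consequently the join of all atoms of the interval [(x,false),(y,true)] in S is bounded above by (y,false), so this interval is not atomic. -/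
/-- In the doubling of a finite lattice at an order-convex subset `C`, if `x ∉ U`,
`y ∈ C` and `x ≤ y`, then every atom of the interval `[(x, false), (y, true)]` is
below `(y, false)`; consequently `(y, true)` is not the least upper bound of
`(x, false)` together with these atoms, i.e. the interval is not atomic. -/
theorem doubling_interval_not_atomic
    {L : Type*} [Lattice L] [Fintype L] (C : Set L)
    (hconv : ∀ x ∈ C, ∀ y ∈ C, ∀ z : L, x ≤ z → z ≤ y → z ∈ C)
    (x y : L) (hx : x ∉ {z : L | ∃ c ∈ C, c ≤ z}) (hy : y ∈ C) (hxy : x ≤ y) :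
    ∀ sx : ↥(doubling C), (sx : L × Bool) = (x, false) →
    ∀ ty : ↥(doubling C), (ty : L × Bool) = (y, true) →
      (∀ z : ↥(doubling C), sx ⋖ z → z ≤ ty → (z : L × Bool) ≤ (y, false)) ∧
      ¬ IsLUB ({sx} ∪ {z : ↥(doubling C) | sx ⋖ z ∧ z ≤ ty}) ty := by
  rintro sx hsx ty hty
  have hyf : ((y, false) : L × Bool) ∈ doubling C :=
    Or.inl ⟨Or.inr hy, rfl⟩
  have key : ∀ z : ↥(doubling C), sx ⋖ z → z ≤ ty → (z : L × Bool) ≤ (y, false) := by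
    rintro ⟨⟨w, b⟩, hz⟩ hcov hle
    have hle' : ((w, b) : L × Bool) ≤ (y, true) := by
      rw [← hty]; exact hle
    have hwy : w ≤ y := hle'.1
    cases b with
    | false => exact ⟨hwy, le_rfl⟩
    | true =>
      exfalso
      have hwU : ∃ c ∈ C, c ≤ w := by
        rcases hz with hz | hz
        · exact absurd hz.2 (by simp)
        · exact hz.1
      obtain ⟨c, hc, hcw⟩ := hwU
      have hwC : w ∈ C := hconv c hc y hy w hcw hwy
      have hwf : ((w, false) : L × Bool) ∈ doubling C :=
        Or.inl ⟨Or.inr hwC, rfl⟩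
      have hxw : ((x, false) : L × Bool) ≤ (w, true) := by
        rw [← hsx]; exact hcov.1.le
      have hne : x ≠ w := by
        rintro rfl
        exact hx ⟨c, hc, hcw⟩
      have hlt : x < w := lt_of_le_of_ne hxw.1 hne
      refine hcov.2 (c := ⟨(w, false), hwf⟩) ?_ ?_
      · change (sx : L × Bool) < (w, false)
        rw [hsx]
        exact Prod.mk_lt_mk.2 (Or.inl ⟨hlt, le_rfl⟩)
      · change ((w, false) : L × Bool) < (w, true)
        exact Prod.mk_lt_mk.2 (Or.inr ⟨le_rfl, by decide⟩)
  refine ⟨key, fun h => ?_⟩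
  have hub : ty ≤ ⟨(y, false), hyf⟩ := by
    apply h.2
    rintro z (hz | hz)
    · rw [Set.mem_singleton_iff.1 hz]
      change (sx : L × Bool) ≤ (y, false)
      rw [hsx]
      exact ⟨hxy, le_rfl⟩
    · exact key z hz.1 hz.2
  have hub' : ((y, true) : L × Bool) ≤ (y, false) := by
    rw [← hty]; exact hub
  exact absurd hub'.2 (by simp)
end

section
/- Let L be a finite lattice, C ⊆ L an order-convex subset, U = {z ∈ L : ∃ c ∈ C, c ≤ z}, and S = (((L \ U) ∪ C) × {false}) ∪ (U × {true}) ⊆ L × Bool with the componentwise order. Suppose x ∈ C, y ∈ U \ C, and x ≤ y. Then the set of atoms of the interval [(x,false),(y,true)] in S, namely {z ∈ S : (x,false) ⋖ z in S and z ≤ (y,true)}, is exactly {(x,true)} ∪ {(a,false) : a ∈ L, x ⋖ a in L, a ≤ y, a ∈ C}. -/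
/-- In the doubling of a finite lattice at an order-convex subset `C`, if `x ∈ C`,
`y ∈ U \ C` and `x ≤ y`, then the atoms of the interval `[(x, false), (y, true)]` are
exactly `(x, true)` together with the pairs `(a, false)` where `a` is an atom of
`[x, y]` in `L` lying in `C`. -/
theorem doubling_interval_atoms
    {L : Type*} [Lattice L] [Fintype L] (C : Set L)
    (hconv : ∀ x ∈ C, ∀ y ∈ C, ∀ z : L, x ≤ z → z ≤ y → z ∈ C)
    (x y : L) (hx : x ∈ C) (hy : y ∈ {z : L | ∃ c ∈ C, c ≤ z} \ C) (hxy : x ≤ y) :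
    ∀ sx : ↥(doubling C), (sx : L × Bool) = (x, false) →
    ∀ ty : ↥(doubling C), (ty : L × Bool) = (y, true) →
      {z : ↥(doubling C) | sx ⋖ z ∧ z ≤ ty} =
        {z : ↥(doubling C) | (z : L × Bool) = (x, true) ∨
          ∃ a : L, x ⋖ a ∧ a ≤ y ∧ a ∈ C ∧ (z : L × Bool) = (a, false)} := by
  rintro ⟨sx, hsx⟩ rfl ⟨ty, hty⟩ rfl
  have memF : ∀ c, c ∈ C → (c, false) ∈ doubling C := fun c hc =>
    Or.inl ⟨Or.inr hc, rfl⟩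
  have memT : ∀ c, x ≤ c → (c, true) ∈ doubling C := fun c hc =>
    Or.inr ⟨⟨x, hx, hc⟩, rfl⟩
  have memF' : ∀ c, x ≤ c → (c, false) ∈ doubling C → c ∈ C := by
    rintro c hc (⟨h | h, -⟩ | ⟨-, h⟩)
    · exact absurd ⟨x, hx, hc⟩ h
    · exact h
    · exact absurd h (by simp)
  ext ⟨⟨b, d⟩, hz⟩
  simp only [Set.mem_setOf_eq]
  constructor
  · rintro ⟨hcov, hle⟩
    have hxb : x ≤ b := hcov.1.le.1
    have hby : b ≤ y := hle.1
    cases d with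
    | true =>
      left
      by_contra hne
      have hlt : x < b := lt_of_le_of_ne hxb (fun h => hne (by rw [h]))
      refine hcov.2 (c := ⟨(x, true), memT x le_rfl⟩) ?_ ?_
      · exact Subtype.mk_lt_mk.2 (Prod.mk_lt_mk_iff_right.2 (by decide))
      · exact Subtype.mk_lt_mk.2 (Prod.mk_lt_mk_iff_left.2 hlt)
    | false =>
      right
      have hb := memF' b hxb hz
      refine ⟨b, ⟨Prod.mk_lt_mk_iff_left.1 (Subtype.mk_lt_mk.1 hcov.1), ?_⟩, hby, hb, rfl⟩
      intro c h1 h2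
      refine hcov.2 (c := ⟨(c, false), memF c (hconv x hx b hb c h1.le h2.le)⟩) ?_ ?_
      · exact Subtype.mk_lt_mk.2 (Prod.mk_lt_mk_iff_left.2 h1)
      · exact Subtype.mk_lt_mk.2 (Prod.mk_lt_mk_iff_left.2 h2)
  · rintro (h | ⟨a, hxa, hay, haC, h⟩)
    · obtain ⟨rfl, rfl⟩ := Prod.mk.inj h
      refine ⟨⟨Subtype.mk_lt_mk.2 (Prod.mk_lt_mk_iff_right.2 (by decide)), ?_⟩, ⟨hxy, le_rfl⟩⟩
      rintro ⟨⟨c, e⟩, hc⟩ h1 h2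
      obtain rfl : b = c := le_antisymm h1.le.1 h2.le.1
      cases e
      · exact lt_irrefl _ h1
      · exact lt_irrefl _ h2
    · obtain ⟨rfl, rfl⟩ := Prod.mk.inj h
      refine ⟨⟨Subtype.mk_lt_mk.2 (Prod.mk_lt_mk_iff_left.2 hxa.1), ?_⟩, ⟨hay, Bool.false_le _⟩⟩
      rintro ⟨⟨c, e⟩, hc⟩ h1 h2
      obtain rfl : e = false := le_antisymm h2.le.2 (Bool.false_le _)
      exact hxa.2 (Prod.mk_lt_mk_iff_left.1 (Subtype.mk_lt_mk.1 h1))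
        (Prod.mk_lt_mk_iff_left.1 (Subtype.mk_lt_mk.1 h2))
end

section
/- Let L be a finite lattice, C ⊆ L an order-convex subset, U = {z ∈ L : ∃ c ∈ C, c ≤ z}, and S = (((L \ U) ∪ C) × {false}) ∪ (U × {true}) ⊆ L × Bool with the componentwise order. Suppose x, y ∈ C and x ≤ y. Then the closed interval {z ∈ S : (x,false) ≤ z ≤ (y,true)} of S is order-isomorphic to the product poset [x,y] × Bool, where [x,y] = {w ∈ L : x ≤ w ≤ y} has the order induced from L and Bool carries the order false < true. -/
/-- In the doubling of a finite lattice at an order-convex subset `C`, if `x, y ∈ C`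
and `x ≤ y`, then the interval `[(x, false), (y, true)]` of the doubling is order
isomorphic to the product `[x, y] × Bool`. -/
theorem doubling_interval_orderIso
    {L : Type*} [Lattice L] [Fintype L] (C : Set L)
    (hconv : ∀ x ∈ C, ∀ y ∈ C, ∀ z : L, x ≤ z → z ≤ y → z ∈ C)
    (x y : L) (hx : x ∈ C) (hy : y ∈ C) (hxy : x ≤ y) :
    Nonempty
      ({z : L × Bool | z ∈ doubling C ∧ (x, false) ≤ z ∧ z ≤ (y, true)} ≃o
        (Set.Icc x y) × Bool) := by
  have hmem : ∀ w : L, ∀ b : Bool, x ≤ w → w ≤ y → (w, b) ∈ doubling C := by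
    intro w b h1 h2
    cases b
    · exact Or.inl ⟨Or.inr (hconv x hx y hy w h1 h2), rfl⟩
    · exact Or.inr ⟨⟨x, hx, h1⟩, rfl⟩
  exact ⟨{
    toFun := fun z => (⟨z.1.1, z.2.2.1.1, z.2.2.2.1⟩, z.1.2)
    invFun := fun p => ⟨(p.1.1, p.2), hmem p.1.1 p.2 p.1.2.1 p.1.2.2,
      ⟨p.1.2.1, Bool.false_le _⟩, ⟨p.1.2.2, Bool.le_true _⟩⟩
    left_inv := fun _ => rfl
    right_inv := fun _ => rfl
    map_rel_iff' := Iff.rfl }⟩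
end

section
/- Let L be a finite lattice admitting an SB-labelling, i.e., a map λ assigning to each covering pair x ⋖ y a label λ(x,y) in some set Λ such that: (SB1) if x ⋖ a, x ⋖ b and a ≠ b, then λ(x,a) ≠ λ(x,b); and (SB2) for every x ∈ L and every nonempty set B of covers of x, every saturated chain x = c₀ ⋖ c₁ ⋖ ⋯ ⋖ c_k = sSup B satisfies {λ(c_{i-1}, c_i) : 1 ≤ i ≤ k} = {λ(x,b) : b ∈ B}. Then L is crosscut-simplicial. -/
theorem exists_saturated_chain_aux {L : Type*} [CompleteLattice L] [Fintype L] (y : L) :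
    ∀ u : L, u ≤ y → ∃ (k : ℕ) (c : Fin (k + 1) → L), c 0 = u ∧ c (Fin.last k) = y ∧
      ∀ i : Fin k, c i.castSucc ⋖ c i.succ := by
  intro u
  induction u using (wellFounded_gt (α := L)).induction with
  | _ u ih =>
    intro hu
    rcases hu.eq_or_lt with rfl | hlt
    · exact ⟨0, fun _ => u, rfl, rfl, fun i => i.elim0⟩
    · obtain ⟨v, huv, hvy⟩ := exists_covBy_le_of_lt hlt
      obtain ⟨k, c, h0, hl, hc⟩ := ih v huv.lt hvy
      refine ⟨k + 1, Fin.cons u c, rfl, ?_, ?_⟩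
      · rw [← Fin.succ_last, Fin.cons_succ, hl]
      · intro i
        refine Fin.cases ?_ (fun j => ?_) i
        · simpa [h0] using huv
        · rw [← Fin.succ_castSucc, Fin.cons_succ, Fin.cons_succ]
          exact hc j

/-- A finite lattice admitting an SB-labelling is crosscut-simplicial.  The labelling
`lab` satisfies (SB1): distinct covers of a common element get distinct labels, and
(SB2): for every `x` and every nonempty set `B` of covers of `x`, the label set of any
saturated chain from `x` to `sSup B` equals `{lab x b : b ∈ B}`. -/
theorem crosscutSimplicial_of_SB_labelling
    {L : Type*} [CompleteLattice L] [Fintype L] {Λ : Type*}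
    (lab : L → L → Λ)
    (hSB1 : ∀ x a b : L, x ⋖ a → x ⋖ b → a ≠ b → lab x a ≠ lab x b)
    (hSB2 : ∀ (x : L) (B : Set L), B.Nonempty → B ⊆ {a : L | x ⋖ a} →
      ∀ (k : ℕ) (c : Fin (k + 1) → L), c 0 = x → c (Fin.last k) = sSup B →
      (∀ i : Fin k, c i.castSucc ⋖ c i.succ) →
      {l : Λ | ∃ i : Fin k, l = lab (c i.castSucc) (c i.succ)} =
        {l : Λ | ∃ b ∈ B, l = lab x b}) :
    ∀ x y : L, x ≤ y → ∀ B : Set L, B ⊂ {z : L | x ⋖ z ∧ z ≤ y} →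
      sSup ({x} ∪ B) ≠ y := by
  intro x y hxy B hB hy
  obtain ⟨hsub, z, ⟨hxz, hzy⟩, hzB⟩ := Set.ssubset_iff_exists.mp hB
  have hne : B.Nonempty := by
    rw [Set.nonempty_iff_ne_empty]
    rintro rfl
    have : x = y := by simpa using hy
    exact absurd (hxz.lt.trans_le hzy) (by simp [this])
  have hyB : y = sSup B := by
    obtain ⟨b, hb⟩ := hne
    rw [← hy, sSup_union, sSup_singleton]
    exact sup_eq_right.mpr ((hsub hb).1.le.trans (le_sSup hb))
  obtain ⟨k, c, h0, hl, hc⟩ := exists_saturated_chain_aux y z hzy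
  have key := hSB2 x B hne (fun b hb => (hsub hb).1) (k + 1) (Fin.cons x c) rfl
    (by rw [← Fin.succ_last, Fin.cons_succ, hl, hyB]) (by
      intro i
      refine Fin.cases ?_ (fun j => ?_) i
      · simpa [h0] using hxz
      · rw [← Fin.succ_castSucc, Fin.cons_succ, Fin.cons_succ]
        exact hc j)
  have hm : lab x z ∈ {l : Λ | ∃ b ∈ B, l = lab x b} := by
    rw [← key]
    exact ⟨0, by simp [h0]⟩
  obtain ⟨b, hb, hlab⟩ := hm
  exact hSB1 x z b hxz (hsub hb).1 (fun h => hzB (h ▸ hb)) hlab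
end
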